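/- Let P be a transition matrix on a finite set D that is irreducible and reversible with respect to a (positive) probability measure π, with second largest eigenvalue β₁ < 1. If (X_n) is a Markov chain with transition matrix P and initial distribution π, then sup over f : D → ℝ with ‖f‖₂ ≤ 1 of e_π(S_n,f)² equals (1+β₁)/(n(1−β₁)) − 2β₁(1−β₁ⁿ)/(n²(1−β₁)²), and this quantity is at most 2/(n(1−β₁)). -/

import Mathlib

open Finset

/-- Expectation, under the Markov chain with transition matrix `P` and initial
distribution `ν`, of a function `g` of the first `m+1` states `X₁,…,X_{m+1}`
(coordinates `0,…,m` of a path). -/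
noncomputable def pathE {D : Type*} [Fintype D] (P : Matrix D D ℝ) (ν : D → ℝ) (m : ℕ)
    (g : (Fin (m + 1) → D) → ℝ) : ℝ :=
  ∑ x : Fin (m + 1) → D, (ν (x 0) * ∏ i : Fin m, P (x i.castSucc) (x i.succ)) * g x

/-- The mean square error `e_ν(S_{n,n₀},f)² = E_{ν,P}|S_{n,n₀}(f) − S(f)|²`, where
`S_{n,n₀}(f) = (1/n) Σ_{j=1}^n f(X_{j+n₀})` and `S(f) = Σ_y f(y) π(y)`. -/
noncomputable def mse {D : Type*} [Fintype D] (P : Matrix D D ℝ) (π ν f : D → ℝ)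
    (n n₀ : ℕ) : ℝ :=
  pathE P ν (n₀ + n) fun x =>
    ((∑ j : Fin n, f (x (Fin.castSucc (Fin.natAdd n₀ j)))) / (n : ℝ) - ∑ y, f y * π y) ^ 2

/-- The sum of `b ^ |i - j|` over `i, j < n`, grouped by the larger index. -/
noncomputable def toeplitzSum (n : ℕ) (b : ℝ) : ℝ :=
  ∑ i ∈ range n, (1 + 2 * (b * ∑ j ∈ range i, b ^ j))

theorem toeplitzSum_mul_sq (n : ℕ) (b : ℝ) :
    toeplitzSum n b * (1 - b) ^ 2 = n * (1 - b) * (1 + b) - 2 * b * (1 - b ^ n) := by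
  induction n with
  | zero => simp [toeplitzSum]
  | succ n ih =>
    have h := mul_neg_geom_sum b n
    rw [toeplitzSum, sum_range_succ, ← toeplitzSum, add_mul, ih]
    push_cast
    linear_combination 2 * b * (1 - b) * h

theorem pow_le_one_of_neg_one_le {b : ℝ} (h : -1 ≤ b) (h' : b ≤ 1) (n : ℕ) : b ^ n ≤ 1 := by
  have := pow_le_one₀ (n := n) (abs_nonneg b) (abs_le.2 ⟨h, h'⟩)
  exact (le_abs_self _).trans (by rwa [abs_pow])

theorem toeplitzSum_mono (n : ℕ) {b c : ℝ} (hc : -1 ≤ c) (hcb : c ≤ b) (hb : b < 1) :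
    toeplitzSum n c ≤ toeplitzSum n b := by
  have hF : 0 ≤ ∑ i ∈ range (n + 1), (1 - b ^ i) * (1 - c ^ (n - i)) :=
    sum_nonneg fun i _ => mul_nonneg
      (sub_nonneg.2 (pow_le_one_of_neg_one_le (hc.trans hcb) hb.le _))
      (sub_nonneg.2 (pow_le_one_of_neg_one_le hc (hcb.trans hb.le) _))
  have hrefl : ∑ i ∈ range (n + 1), c ^ (n - i) = ∑ i ∈ range (n + 1), c ^ i := by
    simpa using sum_range_reflect (fun i => c ^ i) (n + 1)
  have hexp : ∑ i ∈ range (n + 1), (1 - b ^ i) * (1 - c ^ (n - i)) =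
      (n + 1) - ∑ i ∈ range (n + 1), b ^ i - ∑ i ∈ range (n + 1), c ^ i +
        ∑ i ∈ range (n + 1), b ^ i * c ^ (n - i) := by
    rw [← hrefl]
    have : ((n : ℝ) + 1) = ∑ i ∈ range (n + 1), (1 : ℝ) := by simp
    rw [this, ← sum_sub_distrib, ← sum_sub_distrib, ← sum_add_distrib]
    exact sum_congr rfl fun i _ => by ring
  have hgb := mul_neg_geom_sum b (n + 1)
  have hgc := mul_neg_geom_sum c (n + 1)
  have hbc : (∑ i ∈ range (n + 1), b ^ i * c ^ (n - i)) * (b - c) = b ^ (n + 1) - c ^ (n + 1) := by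
    simpa using (Commute.all b c).geom_sum₂_mul (n + 1)
  have hTb := toeplitzSum_mul_sq n b
  have hTc := toeplitzSum_mul_sq n c
  have hb' : 0 < 1 - b := by linarith
  have hc' : 0 < 1 - c := by linarith
  have key : (toeplitzSum n b - toeplitzSum n c) * ((1 - b) ^ 2 * (1 - c) ^ 2) =
      2 * (b - c) * ((1 - b) * (1 - c)) *
        ∑ i ∈ range (n + 1), (1 - b ^ i) * (1 - c ^ (n - i)) := by
    rw [hexp]
    linear_combination (1 - c) ^ 2 * hTb - (1 - b) ^ 2 * hTc
      + 2 * (b - c) * (1 - c) * hgb + 2 * (b - c) * (1 - b) * hgc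
      - 2 * (1 - b) * (1 - c) * hbc
  have hpos : 0 < (1 - b) ^ 2 * (1 - c) ^ 2 := by positivity
  have hrhs : 0 ≤ (toeplitzSum n b - toeplitzSum n c) * ((1 - b) ^ 2 * (1 - c) ^ 2) := by
    rw [key]
    have : 0 ≤ b - c := by linarith
    positivity
  linarith [nonneg_of_mul_nonneg_left hrhs hpos]

theorem toeplitzSum_mul_le (n : ℕ) {b : ℝ} (hb : -1 ≤ b) (hb' : b ≤ 1) :
    toeplitzSum n b * (1 - b) ≤ 2 * n := by
  have hterm : ∀ i ∈ range n, (1 + 2 * (b * ∑ j ∈ range i, b ^ j)) * (1 - b) ≤ 2 := fun i _ => by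
    have h := mul_neg_geom_sum b i
    have h1 : (1 + 2 * (b * ∑ j ∈ range i, b ^ j)) * (1 - b) = 1 + b - 2 * (b * b ^ i) := by
      linear_combination 2 * b * h
    have h2 := pow_le_one_of_neg_one_le hb hb' i
    rw [h1]
    rcases le_total 0 b with h0 | h0
    · have : 0 ≤ b * b ^ i := by positivity
      linarith
    · nlinarith
  rw [toeplitzSum, sum_mul]
  simpa [mul_comm] using sum_le_sum hterm

theorem toeplitzSum_div_sq {n : ℕ} (hn : 1 ≤ n) {b : ℝ} (hb : b < 1) :
    toeplitzSum n b / (n : ℝ) ^ 2 = (1 + b) / ((n : ℝ) * (1 - b)) -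
      2 * b * (1 - b ^ n) / ((n : ℝ) ^ 2 * (1 - b) ^ 2) := by
  have hn' : (n : ℝ) ≠ 0 := by positivity
  have hb' : 1 - b ≠ 0 := by linarith
  rw [div_sub_div _ _ (by positivity) (by positivity), div_eq_div_iff (by positivity) (by positivity)]
  linear_combination (n : ℝ) ^ 3 * (1 - b) * toeplitzSum_mul_sq n b

theorem sum_snoc_castSucc {D : Type*} (h : D → ℝ) (m : ℕ) (x : Fin (m + 1) → D) (y : D) :
    ∑ j : Fin (m + 1), h ((Fin.snoc x y : Fin (m + 2) → D) j.castSucc) =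
      ∑ j : Fin m, h (x j.castSucc) + h (x (Fin.last m)) := by
  simp [Fin.snoc_castSucc, Fin.sum_univ_castSucc]

section PathExpectation

variable {D : Type*} [Fintype D] (P : Matrix D D ℝ) (ν : D → ℝ)

theorem pathE_zero (g : (Fin 1 → D) → ℝ) : pathE P ν 0 g = ∑ y, ν y * g fun _ => y := by
  rw [pathE, ← (Equiv.funUnique (Fin 1) D).symm.sum_comp]
  simp [Equiv.funUnique, uniqueElim_const]
  rfl

theorem pathE_succ (m : ℕ) (g : (Fin (m + 2) → D) → ℝ) :
    pathE P ν (m + 1) g =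
      pathE P ν m fun x => ∑ y, P (x (Fin.last m)) y * g (Fin.snoc x y : Fin (m + 2) → D) := by
  simp only [pathE]
  rw [← (Fin.snocEquiv fun _ : Fin (m + 2) => D).sum_comp, Fintype.sum_prod_type, sum_comm]
  refine sum_congr rfl fun x _ => ?_
  rw [mul_sum]
  refine sum_congr rfl fun y _ => ?_
  have h0 : (Fin.snoc x y : Fin (m + 2) → D) 0 = x 0 := Fin.snoc_castSucc (α := fun _ => D) y x 0
  have hs : ∀ i : Fin m, (Fin.snoc x y : Fin (m + 2) → D) i.castSucc.succ = x i.succ :=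
    fun i => Fin.snoc_castSucc (α := fun _ => D) y x i.succ
  simp [Fin.snocEquiv, Fin.prod_univ_castSucc, h0, hs, Fin.succ_last]
  ring

theorem pathE_add (m : ℕ) (g h : (Fin (m + 1) → D) → ℝ) :
    pathE P ν m (fun x => g x + h x) = pathE P ν m g + pathE P ν m h := by
  simp only [pathE, mul_add, sum_add_distrib]

theorem pathE_const_mul (m : ℕ) (c : ℝ) (g : (Fin (m + 1) → D) → ℝ) :
    pathE P ν m (fun x => c * g x) = c * pathE P ν m g := by
  simp only [pathE, mul_sum]
  exact sum_congr rfl fun x _ => by ring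

theorem pathE_sum {ι : Type*} (s : Finset ι) (m : ℕ) (g : ι → (Fin (m + 1) → D) → ℝ) :
    pathE P ν m (fun x => ∑ k ∈ s, g k x) = ∑ k ∈ s, pathE P ν m (g k) := by
  simp only [pathE, mul_sum]
  exact sum_comm

theorem pathE_nonneg (hP : ∀ x y, 0 ≤ P x y) (hν : ∀ x, 0 ≤ ν x) (m : ℕ)
    {g : (Fin (m + 1) → D) → ℝ} (hg : ∀ x, 0 ≤ g x) : 0 ≤ pathE P ν m g :=
  sum_nonneg fun x _ => mul_nonneg (mul_nonneg (hν _) (prod_nonneg fun _ _ => hP _ _)) (hg x)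

variable {P ν}

theorem pathE_last (hν : ∀ y, ∑ x, ν x * P x y = ν y) (m : ℕ) (g : D → ℝ) :
    pathE P ν m (fun x => g (x (Fin.last m))) = ∑ y, ν y * g y := by
  induction m generalizing g with
  | zero => simp [pathE_zero]
  | succ m ih =>
    simp only [pathE_succ, Fin.snoc_last]
    rw [ih fun z => ∑ y, P z y * g y]
    simp only [mul_sum]
    rw [sum_comm]
    refine sum_congr rfl fun y _ => ?_
    rw [← hν y, sum_mul]
    exact sum_congr rfl fun x _ => by ring

/-- Correlation of the partial sums with an eigenfunction evaluated at the current state. -/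
theorem pathE_sum_mul_eigenfunction (hν : ∀ y, ∑ x, ν x * P x y = ν y) (h v : D → ℝ) {b : ℝ}
    (hv : ∀ x, ∑ y, P x y * v y = b * v x) (m : ℕ) :
    pathE P ν m (fun x => (∑ j : Fin m, h (x j.castSucc)) * v (x (Fin.last m))) =
      (b * ∑ i ∈ range m, b ^ i) * ∑ y, ν y * (h y * v y) := by
  induction m with
  | zero => simp [pathE_zero]
  | succ m ih =>
    have hstep : ∀ x : Fin (m + 1) → D, ∑ y, P (x (Fin.last m)) y *
        ((∑ j : Fin m, h (x j.castSucc) + h (x (Fin.last m))) * v y) =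
        b * ((∑ j : Fin m, h (x j.castSucc)) * v (x (Fin.last m)) +
          h (x (Fin.last m)) * v (x (Fin.last m))) := fun x => by
      rw [← add_mul, mul_left_comm, ← hv, mul_sum]
      exact sum_congr rfl fun y _ => by ring
    simp only [pathE_succ, sum_snoc_castSucc, Fin.snoc_last, hstep]
    rw [pathE_const_mul, pathE_add, ih, pathE_last hν m fun z => h z * v z, geom_sum_succ]
    ring

theorem pathE_sum_sq (hP : ∀ x, ∑ y, P x y = 1) (hν : ∀ y, ∑ x, ν x * P x y = ν y)
    {ι : Type*} [Fintype ι] (u : ι → D → ℝ) (β : ι → ℝ)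
    (hu : ∀ k x, ∑ y, P x y * u k y = β k * u k x) (h : D → ℝ) (c : ι → ℝ)
    (hc : ∀ k, c k = ∑ y, ν y * (h y * u k y)) (hexp : ∀ y, h y = ∑ k, c k * u k y) (m : ℕ) :
    pathE P ν m (fun x => (∑ j : Fin m, h (x j.castSucc)) ^ 2) =
      ∑ k, c k ^ 2 * toeplitzSum m (β k) := by
  have hnorm : ∑ y, ν y * (h y * h y) = ∑ k, c k ^ 2 := by
    have : ∀ y, ν y * (h y * h y) = ∑ k, c k * (ν y * (h y * u k y)) := fun y => by
      conv_lhs => rw [hexp y, mul_sum, mul_sum]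
      rw [← hexp y]
      exact sum_congr rfl fun k _ => by ring
    simp only [this]
    rw [sum_comm]
    exact sum_congr rfl fun k _ => by rw [← mul_sum, ← hc, sq]
  induction m with
  | zero => simp [pathE_zero, toeplitzSum]
  | succ m ih =>
    have hcross : pathE P ν m (fun x => (∑ j : Fin m, h (x j.castSucc)) * h (x (Fin.last m))) =
        ∑ k, c k ^ 2 * (β k * ∑ i ∈ range m, β k ^ i) := by
      have : ∀ x : Fin (m + 1) → D, (∑ j : Fin m, h (x j.castSucc)) * h (x (Fin.last m)) =
          ∑ k, c k * ((∑ j : Fin m, h (x j.castSucc)) * u k (x (Fin.last m))) := fun x => by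
        rw [hexp (x (Fin.last m)), mul_sum]
        exact sum_congr rfl fun k _ => by ring
      simp only [this, pathE_sum, pathE_const_mul]
      refine sum_congr rfl fun k _ => ?_
      rw [pathE_sum_mul_eigenfunction hν h (u k) (hu k), ← hc]
      ring
    have hsq : ∀ x : Fin (m + 1) → D, ∑ y, P (x (Fin.last m)) y *
        (∑ j : Fin m, h (x j.castSucc) + h (x (Fin.last m))) ^ 2 =
        (∑ j : Fin m, h (x j.castSucc)) ^ 2 +
          (2 * ((∑ j : Fin m, h (x j.castSucc)) * h (x (Fin.last m))) +
            h (x (Fin.last m)) * h (x (Fin.last m))) := fun x => by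
      rw [← sum_mul, hP]
      ring
    simp only [pathE_succ, sum_snoc_castSucc, hsq]
    rw [pathE_add, pathE_add, pathE_const_mul, ih, hcross,
      pathE_last hν m fun z => h z * h z, hnorm, mul_sum, ← sum_add_distrib, ← sum_add_distrib]
    refine sum_congr rfl fun k _ => ?_
    rw [toeplitzSum, toeplitzSum, sum_range_succ]
    ring

variable (P ν)

theorem pathE_castLength {n m : ℕ} (e : n = m) (φ : (Fin n → D) → ℝ) :
    pathE P ν m (fun x => φ fun j => x (Fin.castSucc (Fin.cast e j))) =
      pathE P ν n (fun x => φ fun j => x j.castSucc) := by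
  subst e
  rfl

theorem mse_zero_burnIn (π f : D → ℝ) {n : ℕ} (hn : 1 ≤ n) :
    mse P π ν f n 0 =
      pathE P ν n (fun x => (∑ j : Fin n, (f (x j.castSucc) - ∑ y, f y * π y)) ^ 2) /
        (n : ℝ) ^ 2 := by
  have hn' : (n : ℝ) ≠ 0 := by positivity
  have hcast : ∀ j : Fin n, Fin.natAdd 0 j = Fin.cast (Nat.zero_add n).symm j :=
    fun j => Fin.ext (by simp)
  simp only [mse, hcast]
  rw [pathE_castLength P ν (Nat.zero_add n).symm
    fun z => ((∑ j, f (z j)) / (n : ℝ) - ∑ y, f y * π y) ^ 2, div_eq_inv_mul, ← pathE_const_mul]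
  congr 1
  funext x
  rw [sum_sub_distrib, sum_const, card_univ, Fintype.card_fin, nsmul_eq_mul]
  field_simp

end PathExpectation

/-- Expansion in an orthonormal system of full cardinality. -/
theorem eq_sum_of_orthonormal {D ι : Type*} [Fintype D] [DecidableEq D] [Fintype ι] [DecidableEq ι]
    (hcard : Fintype.card ι = Fintype.card D) (π : D → ℝ) (u : ι → D → ℝ)
    (horth : ∀ k l, (∑ x, u k x * u l x * π x) = if k = l then 1 else 0) (h : D → ℝ) (y : D) :
    h y = ∑ k, (∑ x, π x * (h x * u k x)) * u k y := by
  let A : Matrix ι D ℝ := .of fun k x => u k x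
  let B : Matrix D ι ℝ := .of fun x k => u k x * π x
  have hAB : A * B = 1 := by
    ext k l
    simp only [A, B, Matrix.mul_apply, Matrix.of_apply, Matrix.one_apply, ← horth, mul_assoc]
  have hBA : B * A = 1 := (Matrix.mul_eq_one_comm_of_card_eq _ _ _ hcard).1 hAB
  have hxy : ∀ x, ∑ k, u k x * π x * u k y = if x = y then 1 else 0 := fun x => by
    simpa [A, B, Matrix.mul_apply, Matrix.one_apply] using congr_fun (congr_fun hBA x) y
  calc h y = ∑ x, h x * ∑ k, u k x * π x * u k y := by simp [hxy]
    _ = _ := by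
      simp only [mul_sum, sum_mul]
      rw [sum_comm]
      exact sum_congr rfl fun k _ => sum_congr rfl fun x _ => by ring

/-- For an irreducible transition matrix `P` reversible w.r.t. a positive probability
vector `π`, with second largest eigenvalue `β₁ < 1`, the worst-case stationary-start
error `sup_{‖f‖₂ ≤ 1} e_π(S_n,f)²` equals
`(1+β₁)/(n(1−β₁)) − 2β₁(1−β₁ⁿ)/(n²(1−β₁)²)`, which is at most `2/(n(1−β₁))`. -/
theorem stmt2 {D : Type*} [Fintype D] [DecidableEq D] [Nonempty D]
    (P : Matrix D D ℝ) (π : D → ℝ)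
    (hP0 : ∀ x y, 0 ≤ P x y) (hP1 : ∀ x, ∑ y, P x y = 1)
    (hπpos : ∀ x, 0 < π x) (hπ1 : ∑ x, π x = 1)
    (hrev : ∀ x y, π x * P x y = π y * P y x)
    (hirr : ∀ x y, ∃ k : ℕ, 0 < (P ^ k) x y)
    (hcard : 1 < Fintype.card D)
    (β : Fin (Fintype.card D) → ℝ) (u : Fin (Fintype.card D) → D → ℝ)
    (heig : ∀ k x, ∑ y, P x y * u k y = β k * u k x)
    (horth : ∀ k l, (∑ x, u k x * u l x * π x) = if k = l then 1 else 0)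
    (hβ0 : β ⟨0, Fintype.card_pos⟩ = 1)
    (hu0 : ∀ x, u ⟨0, Fintype.card_pos⟩ x = 1)
    (hmono : ∀ k l, k ≤ l → β l ≤ β k)
    (hβbot : ∀ k, -1 ≤ β k)
    (b1 : ℝ) (hb1 : b1 = β ⟨1, hcard⟩) (hb1lt : b1 < 1)
    (n : ℕ) (hn : 1 ≤ n) :
    sSup {r : ℝ | ∃ f : D → ℝ, Real.sqrt (∑ x, f x ^ 2 * π x) ≤ 1 ∧ r = mse P π π f n 0}
        = (1 + b1) / ((n : ℝ) * (1 - b1)) -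
          2 * b1 * (1 - b1 ^ n) / ((n : ℝ) ^ 2 * (1 - b1) ^ 2) ∧
    (1 + b1) / ((n : ℝ) * (1 - b1)) -
        2 * b1 * (1 - b1 ^ n) / ((n : ℝ) ^ 2 * (1 - b1) ^ 2) ≤
      2 / ((n : ℝ) * (1 - b1)) := by
  have hstat : ∀ y, ∑ x, π x * P x y = π y := fun y => by
    simp only [fun x => hrev x y, ← mul_sum, hP1, mul_one]
  set k₀ : Fin (Fintype.card D) := ⟨0, Fintype.card_pos⟩
  set k₁ : Fin (Fintype.card D) := ⟨1, hcard⟩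
  have hne : k₁ ≠ k₀ := by simp [k₀, k₁]
  have hb1bot : -1 ≤ b1 := hb1 ▸ hβbot k₁
  have hn0 : (0 : ℝ) < n := by exact_mod_cast hn
  rw [← toeplitzSum_div_sq hn hb1lt]
  have hmse : ∀ f : D → ℝ, mse P π π f n 0 =
      (∑ k, (∑ x, π x * ((f x - ∑ y, f y * π y) * u k x)) ^ 2 * toeplitzSum n (β k)) /
        (n : ℝ) ^ 2 := fun f => by
    rw [mse_zero_burnIn P π π f hn,
      pathE_sum_sq hP1 hstat u β heig (fun x => f x - ∑ y, f y * π y) _ (fun _ => rfl)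
        (eq_sum_of_orthonormal (Fintype.card_fin _) π u horth _)]
  have hmean : ∑ y, u k₁ y * π y = 0 := by simpa [hu0, hne] using horth k₁ k₀
  have hmse₁ : mse P π π (u k₁) n 0 = toeplitzSum n b1 / (n : ℝ) ^ 2 := by
    have hcoef : ∀ k, ∑ x, π x * (u k₁ x * u k x) = if k₁ = k then 1 else 0 := fun k => by
      rw [← horth]
      exact sum_congr rfl fun x _ => by ring
    rw [hmse]
    simp [hmean, hcoef, hb1]
  have hT : 0 ≤ toeplitzSum n b1 / (n : ℝ) ^ 2 :=
    hmse₁ ▸ pathE_nonneg P π hP0 (fun x => (hπpos x).le) _ fun _ => sq_nonneg _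
  refine ⟨IsGreatest.csSup_eq ⟨⟨u k₁, ?_, hmse₁.symm⟩, ?_⟩, ?_⟩
  · have : ∑ x, u k₁ x ^ 2 * π x = 1 := by simpa [sq] using horth k₁ k₁
    simp [this]
  · rintro _ ⟨f, hf, rfl⟩
    have hf1 : ∑ x, f x ^ 2 * π x ≤ 1 := by simpa using hf
    rw [hmse]
    set s := ∑ y, f y * π y with hs
    set c : Fin (Fintype.card D) → ℝ := fun k => ∑ x, π x * ((f x - s) * u k x) with hc
    have hc₀ : c k₀ = 0 := by
      simp only [hc, hu0, mul_one, mul_sub, sum_sub_distrib, ← sum_mul, hπ1, hs]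
      simp [mul_comm]
    have hparseval : ∑ k, c k ^ 2 = ∑ x, π x * (f x - s) ^ 2 := by
      have hterm : ∀ x, π x * (f x - s) ^ 2 = ∑ k, c k * (π x * ((f x - s) * u k x)) := fun x => by
        have hx := eq_sum_of_orthonormal (Fintype.card_fin _) π u horth (fun x => f x - s) x
        rw [sq]
        nth_rewrite 2 [hx]
        rw [mul_sum, mul_sum]
        exact sum_congr rfl fun k _ => by simp only [hc]; ring
      simp only [hterm]
      rw [sum_comm]
      exact sum_congr rfl fun k _ => by rw [← mul_sum, sq]
    have hvar : ∑ x, π x * (f x - s) ^ 2 = ∑ x, f x ^ 2 * π x - s ^ 2 := by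
      have : ∀ x, π x * (f x - s) ^ 2 = f x ^ 2 * π x - 2 * s * (f x * π x) + s ^ 2 * π x :=
        fun x => by ring
      simp only [this, sum_add_distrib, sum_sub_distrib, ← mul_sum, hπ1, ← hs]
      ring
    have hc1 : ∑ k, c k ^ 2 ≤ 1 := by
      rw [hparseval, hvar]
      linarith [sq_nonneg s]
    have hT' : 0 ≤ toeplitzSum n b1 := by
      simpa [hn0.ne'] using mul_nonneg hT (sq_nonneg (n : ℝ))
    gcongr
    calc ∑ k, c k ^ 2 * toeplitzSum n (β k) ≤ ∑ k, c k ^ 2 * toeplitzSum n b1 := by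
          refine sum_le_sum fun k _ => ?_
          by_cases hk : k = k₀
          · simp [hk, hc₀]
          · have hk₁ : k₁ ≤ k := by
              rw [Fin.le_def]
              exact Nat.one_le_iff_ne_zero.2 fun h => hk (Fin.ext h)
            exact mul_le_mul_of_nonneg_left
              (toeplitzSum_mono n (hβbot k) (hb1 ▸ hmono _ _ hk₁) hb1lt) (sq_nonneg _)
      _ = (∑ k, c k ^ 2) * toeplitzSum n b1 := (sum_mul _ _ _).symm
      _ ≤ toeplitzSum n b1 := mul_le_of_le_one_left hT' hc1
  · have h := toeplitzSum_mul_le n hb1bot hb1lt.le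
    have hb' : 0 < 1 - b1 := by linarith
    rw [div_le_div_iff₀ (by positivity) (by positivity)]
    nlinarith
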